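/- Let X and Y be compact metric spaces, let σ : X → X and F : Y → Y be continuous maps, and let π : X → Y be a homeomorphism with F ∘ π = π ∘ σ. Suppose there are constants c > 0 and K ≥ 1 such that d_Y(π(a), π(b)) ≥ c · d_X(a,b)^K for all a, b ∈ X. If x ∈ X has super-polynomial pointwise emergence with respect to σ, then π(x) has super-polynomial pointwise emergence with respect to F. -/

import Mathlib

open MeasureTheory Filter Set

/-- The first Wasserstein distance between two Borel probability measures on a metric
space: the infimum of `∫ d(x,y) dP` over all couplings `P` of the two measures. -/
noncomputable def wassersteinDist {M : Type*} [MetricSpace M] [MeasurableSpace M]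
    (μ ν : Measure M) : ℝ :=
  sInf { r : ℝ | ∃ P : Measure (M × M), IsProbabilityMeasure P ∧
    P.map Prod.fst = μ ∧ P.map Prod.snd = ν ∧ r = ∫ p, dist p.1 p.2 ∂P }

/-- The `n`-th empirical measure `δ_x^n = (1/n) ∑_{k<n} δ_{f^k x}` of the point `x`. -/
noncomputable def empiricalMeasure {M : Type*} [MetricSpace M] [MeasurableSpace M]
    (f : M → M) (x : M) (n : ℕ) : Measure M :=
  (n : ENNReal)⁻¹ • ∑ k ∈ Finset.range n, Measure.dirac (f^[k] x)

/-- The pointwise emergence `ℰ_{f,x}(ε)`: the least `N ≥ 1` such that there are Borel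
probability measures `μ_1, …, μ_N` with
`limsup_{n→∞} min_{1≤j≤N} d_W(δ_x^n, μ_j) ≤ ε`. -/
noncomputable def pointwiseEmergence {M : Type*} [MetricSpace M] [MeasurableSpace M]
    (f : M → M) (x : M) (ε : ℝ) : ℕ :=
  sInf { N : ℕ | 0 < N ∧ ∃ μs : Fin N → Measure M, (∀ j, IsProbabilityMeasure (μs j)) ∧
    Filter.limsup (fun n : ℕ => ⨅ j, wassersteinDist (empiricalMeasure f x n) (μs j))
      Filter.atTop ≤ ε }

/-- The pointwise emergence of `f` at `x` is super-polynomial: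
`limsup_{ε→0⁺} log ℰ_{f,x}(ε) / (−log ε) = ∞`. -/
def superPolynomialEmergence {M : Type*} [MetricSpace M] [MeasurableSpace M]
    (f : M → M) (x : M) : Prop :=
  Filter.limsup
    (fun ε : ℝ => ((Real.log (pointwiseEmergence f x ε) / (-Real.log ε) : ℝ) : EReal))
    (nhdsWithin 0 (Set.Ioi 0)) = ⊤


theorem integrable_of_continuous {Z : Type*} [TopologicalSpace Z] [CompactSpace Z]
    [T2Space Z] [MeasurableSpace Z] [BorelSpace Z] (R : Measure Z) [IsFiniteMeasure R] {g : Z → ℝ}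
    (hg : Continuous g) : Integrable g R :=
  integrableOn_univ.1 (hg.continuousOn.integrableOn_compact isCompact_univ)

/-- Probability weights can be rounded down to multiples of `1 / m`. -/
theorem exists_nat_div_le_measure {α : Type*} [MeasurableSpace α] (μ : Measure α)
    [IsProbabilityMeasure μ] (s : Set α) {m : ℕ} (hm : 0 < m) :
    ∃ k : Fin (m + 1), (k : ENNReal) / m ≤ μ s ∧ μ s ≤ (k : ENNReal) / m + (m : ENNReal)⁻¹ := by
  have hm' : (0 : ℝ) < m := by exact_mod_cast hm
  have hs : μ.real s ≤ 1 := measureReal_le_one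
  have h0 : 0 ≤ m * μ.real s := by positivity
  have hfl := Nat.floor_le h0
  have hlt := Nat.lt_floor_add_one (m * μ.real s)
  refine ⟨⟨⌊m * μ.real s⌋₊, ?_⟩, ?_, ?_⟩
  · have : (⌊m * μ.real s⌋₊ : ℝ) ≤ m := hfl.trans (by nlinarith)
    exact Nat.lt_succ_of_le (by exact_mod_cast this)
  · rw [← ofReal_measureReal (μ := μ) (s := s), ← ENNReal.ofReal_natCast m,
      ← ENNReal.ofReal_natCast, ← ENNReal.ofReal_div_of_pos hm']
    apply ENNReal.ofReal_le_ofReal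
    rw [div_le_iff₀ hm']
    linarith
  · rw [← ofReal_measureReal (μ := μ) (s := s), ← ENNReal.ofReal_natCast m,
      ← ENNReal.ofReal_natCast, ← ENNReal.ofReal_div_of_pos hm', ← ENNReal.ofReal_inv_of_pos hm',
      ← ENNReal.ofReal_add (by positivity) (by positivity)]
    apply ENNReal.ofReal_le_ofReal
    have : (⌊m * μ.real s⌋₊ : ℝ) / m + (m : ℝ)⁻¹ = (⌊m * μ.real s⌋₊ + 1) / m := by
      field_simp
    rw [this, le_div_iff₀ hm']
    linarith

/-- The measure obtained by pushing `κ` forward along `p` and placing the missing mass at `y₀`. -/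
noncomputable def completedMap {ι M : Type*} [MeasurableSpace ι] [MeasurableSpace M]
    (p : ι → M) (y₀ : M) (κ : Measure ι) : Measure M :=
  κ.map p + (1 - κ univ) • Measure.dirac y₀

section Wasserstein

variable {M : Type*} [MetricSpace M] [MeasurableSpace M]

theorem wassersteinDist_nonneg (μ ν : Measure M) : 0 ≤ wassersteinDist μ ν := by
  refine Real.sInf_nonneg ?_
  rintro r ⟨P, -, -, -, rfl⟩
  exact integral_nonneg fun p => dist_nonneg

theorem wassersteinDist_le_integral {μ ν : Measure M} (P : Measure (M × M))
    [IsProbabilityMeasure P] (hfst : P.map Prod.fst = μ) (hsnd : P.map Prod.snd = ν) :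
    wassersteinDist μ ν ≤ ∫ p, dist p.1 p.2 ∂P := by
  refine csInf_le ⟨0, ?_⟩ ⟨P, inferInstance, hfst, hsnd, rfl⟩
  rintro r ⟨Q, -, -, -, rfl⟩
  exact integral_nonneg fun p => dist_nonneg

theorem isProbabilityMeasure_empiricalMeasure (f : M → M) (x : M) {n : ℕ} (hn : n ≠ 0) :
    IsProbabilityMeasure (empiricalMeasure f x n) := by
  constructor
  simp only [empiricalMeasure, Measure.smul_apply, Measure.finsetSum_apply, measure_univ,
    Finset.sum_const, Finset.card_range, nsmul_eq_mul, mul_one, smul_eq_mul]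
  exact ENNReal.inv_mul_cancel (by exact_mod_cast hn) (ENNReal.natCast_ne_top n)

theorem isCoboundedUnder_iInf_wassersteinDist (f : M → M) (x : M) {N : ℕ}
    (μs : Fin N → Measure M) :
    IsCoboundedUnder (· ≤ ·) atTop
      fun n : ℕ => ⨅ j, wassersteinDist (empiricalMeasure f x n) (μs j) :=
  (isBoundedUnder_of ⟨0, fun _ =>
    Real.iInf_nonneg fun _ => wassersteinDist_nonneg _ _⟩).isCoboundedUnder_le

variable [CompactSpace M]

theorem wassersteinDist_le_diam (μ ν : Measure M) [IsProbabilityMeasure μ]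
    [IsProbabilityMeasure ν] : wassersteinDist μ ν ≤ Metric.diam (univ : Set M) := by
  have hle := wassersteinDist_le_integral (μ.prod ν) (μ := μ) (ν := ν)
    (by simp [Measure.map_fst_prod]) (by simp [Measure.map_snd_prod])
  refine hle.trans ?_
  have h := norm_integral_le_of_norm_le_const (μ := μ.prod ν)
    (f := fun p : M × M => dist p.1 p.2) (C := Metric.diam (univ : Set M))
    (Eventually.of_forall fun p => by
      rw [Real.norm_of_nonneg dist_nonneg]
      exact Metric.dist_le_diam_of_mem isCompact_univ.isBounded (mem_univ _) (mem_univ _))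
  simpa using (le_abs_self _).trans h

theorem isBoundedUnder_iInf_wassersteinDist (f : M → M) (x : M) {N : ℕ}
    (μs : Fin N → Measure M) (hμs : ∀ j, IsProbabilityMeasure (μs j)) :
    IsBoundedUnder (· ≤ ·) atTop
      fun n : ℕ => ⨅ j, wassersteinDist (empiricalMeasure f x n) (μs j) := by
  refine ⟨Metric.diam (univ : Set M), ?_⟩
  rw [eventually_map]
  filter_upwards [eventually_ne_atTop 0] with n hn
  have := isProbabilityMeasure_empiricalMeasure f x hn
  rcases isEmpty_or_nonempty (Fin N) with h | ⟨⟨j⟩⟩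
  · rw [Real.iInf_of_isEmpty]
    exact Metric.diam_nonneg
  · exact (ciInf_le (Set.finite_range _).bddBelow j).trans (wassersteinDist_le_diam _ _)

variable [BorelSpace M]

theorem exists_measurable_dist_le {ε : ℝ} (hε : 0 < ε) [Nonempty M] :
    ∃ (m : ℕ) (q : M → Fin (m + 1)) (p : Fin (m + 1) → M), Measurable q ∧
      ∀ y, dist y (p (q y)) ≤ ε := by
  let e := TopologicalSpace.denseSeq M
  obtain ⟨t, ht⟩ := isCompact_univ.elim_finite_subcover (fun k => Metric.ball (e k) ε)
    (fun k => Metric.isOpen_ball) (fun y _ => by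
      obtain ⟨_, ⟨k, rfl⟩, hk⟩ := Metric.mem_closure_iff.1
        (TopologicalSpace.denseRange_denseSeq M y) ε hε
      exact mem_iUnion.2 ⟨k, hk⟩)
  let N := t.sup id
  refine ⟨N, fun y => Fin.ofNat (N + 1) (SimpleFunc.nearestPtInd e N y), fun i => e i,
    (measurable_of_countable (Fin.ofNat (N + 1))).comp (SimpleFunc.measurable _), fun y => ?_⟩
  obtain ⟨k, hkt, hk⟩ := mem_iUnion₂.1 (ht (mem_univ y))
  have h := SimpleFunc.edist_nearestPt_le e y (Finset.le_sup (f := id) hkt : k ≤ N)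
  rw [edist_dist, edist_dist, ENNReal.ofReal_le_ofReal_iff dist_nonneg] at h
  have hmod : ((Fin.ofNat (N + 1) (SimpleFunc.nearestPtInd e N y) : Fin (N + 1)) : ℕ)
      = SimpleFunc.nearestPtInd e N y :=
    Nat.mod_eq_of_lt (Nat.lt_succ_of_le (SimpleFunc.nearestPtInd_le e N y))
  beta_reduce
  rw [hmod, dist_comm]
  rw [Metric.mem_ball, dist_comm] at hk
  exact h.trans hk.le

/-- Keep the fraction `a (q y)` of the mass at `y` moving to `p (q y)` and send the rest to `y₀`. -/
theorem wassersteinDist_completedMap_le {ι : Type*} [Fintype ι] [MeasurableSpace ι]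
    [MeasurableSingletonClass ι] (μ : Measure M) [IsProbabilityMeasure μ] {q : M → ι}
    (hq : Measurable q) (p : ι → M) (y₀ : M) {ε η : ℝ} (hε : 0 ≤ ε) (hη : 0 ≤ η)
    (hpq : ∀ y, dist y (p (q y)) ≤ ε) (κ : Measure ι)
    (hκ : ∀ i, κ {i} ≤ μ.map q {i}) (hκ' : ∀ i, μ.map q {i} ≤ κ {i} + ENNReal.ofReal η) :
    IsProbabilityMeasure (completedMap p y₀ κ) ∧
      wassersteinDist μ (completedMap p y₀ κ) ≤
        ε + Metric.diam (univ : Set M) * (Fintype.card ι * η) := by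
  have hprobq : IsProbabilityMeasure (μ.map q) := Measure.isProbabilityMeasure_map hq.aemeasurable
  let a : ι → ENNReal := fun i => κ {i} / μ.map q {i}
  have ha : Measurable a := measurable_of_countable a
  have ha1 : ∀ i, a i ≤ 1 := fun i => ENNReal.div_le_of_le_mul (by simpa using hκ i)
  have haw : ∀ i, a i * μ.map q {i} = κ {i} := fun i =>
    ENNReal.div_mul_cancel' (fun h => le_antisymm (h ▸ hκ i) zero_le)
      (fun h => absurd h (measure_ne_top _ _))
  let μ₁ := μ.withDensity (a ∘ q)
  let μ₂ := μ.withDensity ((fun i => 1 - a i) ∘ q)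
  have hsum : μ₁ + μ₂ = μ := by
    rw [← withDensity_add_left (ha.comp hq)]
    convert withDensity_one (μ := μ) using 2
    ext y
    exact add_tsub_cancel_of_le (ha1 (q y))
  have hμ₁q : μ₁.map q = κ := by
    refine Measure.ext_of_singleton fun i => ?_
    have hi := measurableSet_singleton i
    rw [Measure.map_apply hq hi, withDensity_apply _ (hq hi),
      setLIntegral_congr_fun (g := fun _ => a i) (hq hi) (fun y hy => by
        simp only [Function.comp_apply]; rw [mem_singleton_iff.1 hy]),
      setLIntegral_const, ← Measure.map_apply hq hi, haw]
  have huniv : μ₁ univ + μ₂ univ = 1 := by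
    rw [← Measure.add_apply, hsum, measure_univ]
  have hμ₁univ : μ₁ univ = κ univ := by
    rw [← hμ₁q, Measure.map_apply hq MeasurableSet.univ, preimage_univ]
  have hκtop : κ univ ≠ ⊤ := by
    rw [← hμ₁univ]
    exact ne_top_of_le_ne_top ENNReal.one_ne_top (huniv ▸ le_self_add)
  have hμ₂univ : μ₂ univ = 1 - κ univ := by
    rw [← huniv, hμ₁univ, ENNReal.add_sub_cancel_left hκtop]
  have hμ₂le : μ₂ univ ≤ ENNReal.ofReal (Fintype.card ι * η) := by
    rw [withDensity_apply _ MeasurableSet.univ, Measure.restrict_univ]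
    simp only [Function.comp_apply]
    rw [← lintegral_map (f := fun i => 1 - a i) (measurable_of_countable _) hq,
      lintegral_fintype, ENNReal.ofReal_mul (by positivity), ENNReal.ofReal_natCast]
    refine (Finset.sum_le_card_nsmul _ _ (ENNReal.ofReal η) fun i _ => ?_).trans_eq
      (by rw [nsmul_eq_mul, Finset.card_univ])
    rw [ENNReal.sub_mul fun _ _ => measure_ne_top _ _, one_mul, haw]
    exact tsub_le_iff_left.2 (hκ' i)
  have hp : Measurable p := measurable_of_countable p
  have hf₁ : Measurable fun y => (y, p (q y)) := measurable_id.prodMk (hp.comp hq)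
  have hf₂ : Measurable fun y : M => (y, y₀) := measurable_id.prodMk measurable_const
  let P := μ₁.map (fun y => (y, p (q y))) + μ₂.map fun y => (y, y₀)
  have hfst : P.map Prod.fst = μ := by
    rw [Measure.map_add _ _ measurable_fst, Measure.map_map measurable_fst hf₁,
      Measure.map_map measurable_fst hf₂]
    simpa [Function.comp_def] using hsum
  have hsnd : P.map Prod.snd = completedMap p y₀ κ := by
    rw [Measure.map_add _ _ measurable_snd, Measure.map_map measurable_snd hf₁,
      Measure.map_map measurable_snd hf₂, completedMap, ← hμ₂univ]
    conv_rhs => rw [← hμ₁q, Measure.map_map hp hq]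
    simp only [Function.comp_def, Measure.map_const]
  have hP : IsProbabilityMeasure P := by
    constructor
    rw [← preimage_univ (f := Prod.fst), ← Measure.map_apply measurable_fst MeasurableSet.univ,
      hfst, measure_univ]
  have hD : 0 ≤ Metric.diam (univ : Set M) := Metric.diam_nonneg
  refine ⟨hsnd ▸ Measure.isProbabilityMeasure_map measurable_snd.aemeasurable,
    (wassersteinDist_le_integral P hfst hsnd).trans ?_⟩
  have hdm : Measurable fun z : M × M => dist z.1 z.2 := measurable_dist
  rw [integral_eq_lintegral_of_nonneg_ae (Eventually.of_forall fun _ => dist_nonneg)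
    hdm.aestronglyMeasurable]
  refine ENNReal.toReal_le_of_le_ofReal (by positivity) ?_
  rw [lintegral_add_measure, lintegral_map hdm.ennreal_ofReal hf₁,
    lintegral_map hdm.ennreal_ofReal hf₂, ENNReal.ofReal_add hε (by positivity),
    ENNReal.ofReal_mul hD]
  refine add_le_add ?_ ?_
  · calc ∫⁻ y, ENNReal.ofReal (dist y (p (q y))) ∂μ₁ ≤ ∫⁻ _, ENNReal.ofReal ε ∂μ₁ :=
          lintegral_mono fun y => ENNReal.ofReal_le_ofReal (hpq y)
      _ = ENNReal.ofReal ε * μ₁ univ := lintegral_const _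
      _ ≤ ENNReal.ofReal ε * 1 := by gcongr; exact huniv ▸ le_self_add
      _ = ENNReal.ofReal ε := mul_one _
  · calc ∫⁻ y, ENNReal.ofReal (dist y y₀) ∂μ₂
        ≤ ∫⁻ _, ENNReal.ofReal (Metric.diam (univ : Set M)) ∂μ₂ :=
          lintegral_mono fun y => ENNReal.ofReal_le_ofReal
            (Metric.dist_le_diam_of_mem isCompact_univ.isBounded (mem_univ _) (mem_univ _))
      _ = ENNReal.ofReal (Metric.diam (univ : Set M)) * μ₂ univ := lintegral_const _
      _ ≤ _ := by gcongr

/-- The probability measures on a compact metric space are totally bounded for `wassersteinDist`. -/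
theorem exists_finite_wassersteinDist_net [Nonempty M] {ε : ℝ} (hε : 0 < ε) :
    ∃ T : Set (Measure M), T.Finite ∧ (∀ ν ∈ T, IsProbabilityMeasure ν) ∧
      ∀ μ : Measure M, IsProbabilityMeasure μ → ∃ ν ∈ T, wassersteinDist μ ν ≤ ε := by
  obtain ⟨m, q, p, hq, hpq⟩ := exists_measurable_dist_le (M := M) (half_pos hε)
  have y₀ : M := Classical.arbitrary M
  have hD : 0 ≤ Metric.diam (univ : Set M) := Metric.diam_nonneg
  obtain ⟨N, hN⟩ := exists_nat_gt (Metric.diam (univ : Set M) * (m + 1) / (ε / 2))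
  have hN0 : (0 : ℝ) < N := lt_of_le_of_lt (by positivity) hN
  let κ : (Fin (m + 1) → Fin (N + 1)) → Measure (Fin (m + 1)) := fun k =>
    ∑ i, ((k i : ENNReal) / N) • Measure.dirac i
  have hκ : ∀ k i, κ k {i} = (k i : ENNReal) / N := fun k i => by
    simp [κ, Measure.finsetSum_apply, Set.indicator_apply]
  refine ⟨{ν | ν ∈ range (fun k => completedMap p y₀ (κ k)) ∧ IsProbabilityMeasure ν},
    (finite_range _).subset fun ν hν => hν.1, fun ν hν => hν.2, fun μ hμ => ?_⟩
  have hμq : IsProbabilityMeasure (μ.map q) := Measure.isProbabilityMeasure_map hq.aemeasurable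
  choose k hk hk' using fun i : Fin (m + 1) =>
    exists_nat_div_le_measure (μ.map q) {i} (m := N) (by exact_mod_cast hN0)
  obtain ⟨hprob, hle⟩ := wassersteinDist_completedMap_le μ hq p y₀ (half_pos hε).le
    (inv_nonneg.2 hN0.le) hpq (κ k) (fun i => (hκ k i).trans_le (hk i)) (fun i => by
      rw [hκ, ENNReal.ofReal_inv_of_pos hN0, ENNReal.ofReal_natCast]
      exact hk' i)
  refine ⟨_, ⟨⟨k, rfl⟩, hprob⟩, hle.trans ?_⟩
  rw [div_lt_iff₀ (half_pos hε)] at hN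
  have : Metric.diam (univ : Set M) * (Fintype.card (Fin (m + 1)) * (N : ℝ)⁻¹) ≤ ε / 2 := by
    rw [Fintype.card_fin, ← mul_assoc, ← div_eq_mul_inv, div_le_iff₀ hN0]
    push_cast
    linarith
  linarith

theorem exists_measures_limsup_wassersteinDist_le (f : M → M) (x : M) {ε : ℝ} (hε : 0 < ε) :
    { N : ℕ | 0 < N ∧ ∃ μs : Fin N → Measure M, (∀ j, IsProbabilityMeasure (μs j)) ∧
      limsup (fun n : ℕ => ⨅ j, wassersteinDist (empiricalMeasure f x n) (μs j))
        atTop ≤ ε }.Nonempty := by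
  have : Nonempty M := ⟨x⟩
  obtain ⟨T, hT, hprob, hnet⟩ := exists_finite_wassersteinDist_net (M := M) hε
  obtain ⟨ν₀, hν₀, -⟩ := hnet (Measure.dirac x) inferInstance
  have := hT.to_subtype
  have : Nonempty T := ⟨⟨ν₀, hν₀⟩⟩
  let φ := Finite.equivFin T
  refine ⟨Nat.card T, Nat.card_pos, fun j => (φ.symm j : Measure M),
    fun j => hprob _ (φ.symm j).2,
    limsup_le_of_le (isCoboundedUnder_iInf_wassersteinDist f x _) ?_⟩
  filter_upwards [eventually_ne_atTop 0] with n hn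
  obtain ⟨ν, hν, hle⟩ := hnet _ (isProbabilityMeasure_empiricalMeasure f x hn)
  refine (ciInf_le (finite_range _).bddBelow (φ ⟨ν, hν⟩)).trans ?_
  rwa [Equiv.symm_apply_apply]

end Wasserstein

section Conjugacy

theorem map_empiricalMeasure {X Y : Type*} [MetricSpace X] [MeasurableSpace X] [BorelSpace X]
    [MetricSpace Y] [MeasurableSpace Y] [BorelSpace Y] {σ : X → X} {F : Y → Y} {π : X ≃ₜ Y}
    (hconj : ∀ a, F (π a) = π (σ a)) (x : X) (n : ℕ) :
    (empiricalMeasure σ x n).map π = empiricalMeasure F (π x) n := by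
  have hsemi : Function.Semiconj π σ F := fun a => (hconj a).symm
  have hπ : Measurable π := π.measurable
  simp only [empiricalMeasure, Measure.map_smul]
  rw [← Measure.mapₗ_apply_of_measurable hπ, map_sum]
  simp only [Measure.mapₗ_apply_of_measurable hπ, Measure.map_dirac' hπ]
  congr 1
  exact Finset.sum_congr rfl fun k _ => by rw [(hsemi.iterate_right k).eq x]

variable {X Y : Type*} [MetricSpace X] [CompactSpace X] [MeasurableSpace X] [BorelSpace X]
  [MetricSpace Y] [CompactSpace Y] [MeasurableSpace Y] [BorelSpace Y]

theorem mul_wassersteinDist_rpow_le (π : X ≃ₜ Y) {c K : ℝ} (hc : 0 < c) (hK : 1 ≤ K)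
    (hdist : ∀ a b : X, c * dist a b ^ K ≤ dist (π a) (π b)) (μ : Measure X) (ν : Measure Y)
    [IsProbabilityMeasure μ] [IsProbabilityMeasure ν] :
    c * wassersteinDist μ (ν.map π.symm) ^ K ≤ wassersteinDist (μ.map π) ν := by
  have hπ : Measurable π := π.measurable
  have hπ' : Measurable π.symm := π.symm.measurable
  have : IsProbabilityMeasure (μ.map π) := Measure.isProbabilityMeasure_map hπ.aemeasurable
  refine le_csInf ⟨_, (μ.map π).prod ν, inferInstance, by simp [Measure.map_fst_prod],
    by simp [Measure.map_snd_prod], rfl⟩ ?_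
  rintro r ⟨P, hP, hfst, hsnd, rfl⟩
  let Φ : Y × Y → X × X := Prod.map π.symm π.symm
  have hΦ : Measurable Φ := hπ'.prodMap hπ'
  have hQ : IsProbabilityMeasure (P.map Φ) := Measure.isProbabilityMeasure_map hΦ.aemeasurable
  have hW : wassersteinDist μ (ν.map π.symm) ≤ ∫ z, dist z.1 z.2 ∂(P.map Φ) := by
    refine wassersteinDist_le_integral _ ?_ ?_
    · rw [Measure.map_map measurable_fst hΦ]
      change P.map (π.symm ∘ Prod.fst) = μ
      rw [← Measure.map_map hπ' measurable_fst, hfst, Measure.map_map hπ' hπ]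
      simp
    · rw [Measure.map_map measurable_snd hΦ]
      change P.map (π.symm ∘ Prod.snd) = _
      rw [← Measure.map_map hπ' measurable_snd, hsnd]
  have hK0 : 0 ≤ K := zero_le_one.trans hK
  have hcont : Continuous fun z : X × X => dist z.1 z.2 ^ K :=
    continuous_dist.rpow_const fun _ => Or.inr hK0
  have hjensen := (convexOn_rpow hK).map_integral_le (μ := P.map Φ)
    (f := fun z : X × X => dist z.1 z.2)
    (Real.continuous_rpow_const hK0).continuousOn isClosed_Ici
    (Eventually.of_forall fun z => dist_nonneg)
    (integrable_of_continuous _ continuous_dist) (integrable_of_continuous _ hcont)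
  calc c * wassersteinDist μ (ν.map π.symm) ^ K
      ≤ c * ∫ z, dist z.1 z.2 ^ K ∂(P.map Φ) := by
        refine mul_le_mul_of_nonneg_left (le_trans ?_ hjensen) hc.le
        exact Real.rpow_le_rpow (wassersteinDist_nonneg _ _) hW hK0
    _ = ∫ z, c * dist z.1 z.2 ^ K ∂(P.map Φ) := (integral_const_mul _ _).symm
    _ = ∫ w, c * dist (π.symm w.1) (π.symm w.2) ^ K ∂P :=
        integral_map hΦ.aemeasurable (hcont.const_mul c).aestronglyMeasurable
    _ ≤ ∫ w, dist w.1 w.2 ∂P := by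
        refine integral_mono (integrable_of_continuous _ ?_)
          (integrable_of_continuous _ continuous_dist) fun w => ?_
        · exact (hcont.const_mul c).comp (π.symm.continuous.prodMap π.symm.continuous)
        · simpa using hdist (π.symm w.1) (π.symm w.2)

theorem pointwiseEmergence_le_of_conjugacy {σ : X → X} {F : Y → Y} {π : X ≃ₜ Y}
    (hconj : ∀ a, F (π a) = π (σ a)) {c K : ℝ} (hc : 0 < c) (hK : 1 ≤ K)
    (hdist : ∀ a b : X, c * dist a b ^ K ≤ dist (π a) (π b)) (x : X) {ε : ℝ} (hε : 0 < ε) :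
    pointwiseEmergence σ x ε ≤ pointwiseEmergence F (π x) (c * ε ^ K) := by
  have hK0 : 0 < K := zero_lt_one.trans_le hK
  refine csInf_le_csInf (OrderBot.bddBelow _)
    (exists_measures_limsup_wassersteinDist_le F (π x) (by positivity)) ?_
  rintro N ⟨hN, μs, hμs, hlim⟩
  have hprob : ∀ j, IsProbabilityMeasure ((μs j).map π.symm) := fun j =>
    Measure.isProbabilityMeasure_map π.symm.measurable.aemeasurable
  refine ⟨hN, fun j => (μs j).map π.symm, hprob, le_of_forall_gt_imp_ge_of_dense fun r hr => ?_⟩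
  have hr0 : 0 ≤ r := (hε.trans hr).le
  have hlt : c * ε ^ K < c * r ^ K :=
    mul_lt_mul_of_pos_left (Real.rpow_lt_rpow hε.le hr hK0) hc
  refine limsup_le_of_le (isCoboundedUnder_iInf_wassersteinDist σ x _) ?_
  filter_upwards [eventually_ne_atTop 0, eventually_lt_of_limsup_lt (hlim.trans_lt hlt)
    (isBoundedUnder_iInf_wassersteinDist F (π x) μs hμs)] with n hn hlt
  have := isProbabilityMeasure_empiricalMeasure σ x hn
  have : Nonempty (Fin N) := ⟨⟨0, hN⟩⟩
  obtain ⟨j, hj⟩ := exists_eq_ciInf_of_finite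
    (f := fun j => wassersteinDist (empiricalMeasure F (π x) n) (μs j))
  have hle := mul_wassersteinDist_rpow_le π hc hK hdist (empiricalMeasure σ x n) (μs j)
  rw [map_empiricalMeasure hconj, hj] at hle
  refine (ciInf_le (finite_range _).bddBelow j).trans ?_
  exact ((Real.rpow_lt_rpow_iff (wassersteinDist_nonneg _ _) hr0 hK0).1
    (lt_of_mul_lt_mul_left (hle.trans_lt hlt) hc.le)).le

end Conjugacy

/-- Let `X`, `Y` be compact metric spaces, `σ : X → X`, `F : Y → Y`
continuous, and `π : X → Y` a homeomorphism with `F ∘ π = π ∘ σ`. Suppose there are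
constants `c > 0` and `K ≥ 1` with `d(π a, π b) ≥ c · d(a,b)^K` for all `a, b`. If `x`
has super-polynomial pointwise emergence for `σ`, then `π x` has super-polynomial
pointwise emergence for `F`. -/
theorem superPolynomialEmergence_of_conjugacy
    {X Y : Type*} [MetricSpace X] [CompactSpace X] [MeasurableSpace X] [BorelSpace X]
    [MetricSpace Y] [CompactSpace Y] [MeasurableSpace Y] [BorelSpace Y]
    (σ : X → X) (hσ : Continuous σ) (F : Y → Y) (hF : Continuous F)
    (π : X ≃ₜ Y) (hconj : ∀ a, F (π a) = π (σ a))
    (c K : ℝ) (hc : 0 < c) (hK : 1 ≤ K)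
    (hdist : ∀ a b : X, c * dist a b ^ K ≤ dist (π a) (π b))
    (x : X) (hx : superPolynomialEmergence σ x) :
    superPolynomialEmergence F (π x) := by
  have hK0 : 0 < K := zero_lt_one.trans_le hK
  unfold superPolynomialEmergence at hx ⊢
  refine EReal.eq_top_iff_forall_lt _ |>.2 fun A => ?_
  obtain ⟨B, hAB, hB⟩ : ∃ B : ℝ, A < B ∧ 0 < B :=
    ⟨max A 0 + 1, by linarith [le_max_left A 0], by linarith [le_max_right A 0]⟩
  refine lt_of_lt_of_le (EReal.coe_lt_coe_iff.2 hAB) (le_limsup_of_frequently_le' ?_)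
  have hfreq : ∃ᶠ ε : ℝ in nhdsWithin 0 (Ioi 0), ((2 * K * B : ℝ) : EReal) <
      ((Real.log (pointwiseEmergence σ x ε) / (-Real.log ε) : ℝ) : EReal) :=
    frequently_lt_of_lt_limsup (h := hx ▸ EReal.coe_lt_top _)
  have htend : Tendsto (fun ε : ℝ => c * ε ^ K) (nhdsWithin 0 (Ioi 0))
      (nhdsWithin 0 (Ioi 0)) := by
    refine tendsto_nhdsWithin_iff.2 ⟨?_, ?_⟩
    · have h := ((Real.continuous_rpow_const hK0.le).const_mul c).tendsto 0
      rw [Real.zero_rpow hK0.ne', mul_zero] at h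
      exact h.mono_left nhdsWithin_le_nhds
    · filter_upwards [self_mem_nhdsWithin] with ε hε
      exact mul_pos hc (Real.rpow_pos_of_pos hε K)
  have hneglog : Tendsto (fun ε : ℝ => -Real.log ε) (nhdsWithin 0 (Ioi 0)) atTop :=
    tendsto_neg_atBot_atTop.comp Real.tendsto_log_nhdsGT_zero
  refine htend.frequently ((hfreq.and_eventually (eventually_mem_nhdsWithin.and
    ((hneglog.eventually_gt_atTop (|Real.log c| / K)).and
      (hneglog.eventually_gt_atTop 0)))).mono ?_)
  rintro ε ⟨hlt, hε, hlarge, hpos⟩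
  replace hε : 0 < ε := hε
  rw [EReal.coe_lt_coe_iff, lt_div_iff₀ hpos] at hlt
  rw [div_lt_iff₀ hK0] at hlarge
  have hlog : -Real.log (c * ε ^ K) = -Real.log c + K * -Real.log ε := by
    rw [Real.log_mul hc.ne' (Real.rpow_pos_of_pos hε K).ne', Real.log_rpow hε]
    ring
  have hmono : Real.log (pointwiseEmergence σ x ε) ≤
      Real.log (pointwiseEmergence F (π x) (c * ε ^ K)) := by
    have hle := pointwiseEmergence_le_of_conjugacy hconj hc hK hdist x hε
    rcases Nat.eq_zero_or_pos (pointwiseEmergence σ x ε) with h | h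
    · rw [h, Nat.cast_zero, Real.log_zero]
      exact Real.log_natCast_nonneg _
    · exact Real.log_le_log (by exact_mod_cast h) (by exact_mod_cast hle)
  rw [EReal.coe_le_coe_iff, hlog, le_div_iff₀ (by linarith [le_abs_self (Real.log c)])]
  nlinarith [neg_abs_le (Real.log c)]
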